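/- Let n ≥ 1 and let S_1, S_2, …, S_n be finite sets all contained in a finite ground set G, and let k ≥ l be positive integers such that |S_i| ≥ k for all i and |S_i ∩ S_j| ≤ l for all i ≠ j. If l·|G| < k², then n ≤ (|G|/k) / (1 − l·|G|/k²). -/

import Mathlib

/-- Cauchy–Schwarz double counting: the total size of a family of subsets of `G` is controlled by
the sizes of the pairwise intersections. -/
theorem Finset.sq_sum_card_le_card_mul_sum_card_inter {α ι : Type*} [DecidableEq α] [Fintype ι]
    (G : Finset α) (T : ι → Finset α) (hT : ∀ i, T i ⊆ G) :
    (∑ i, (T i).card) ^ 2 ≤ G.card * ∑ i, ∑ j, (T i ∩ T j).card := by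
  have hcard : ∀ A ⊆ G, ∑ x ∈ G, (if x ∈ A then 1 else 0) = A.card := fun A hA => by
    rw [← Finset.card_filter, Finset.filter_mem_eq_inter, Finset.inter_eq_right.mpr hA]
  have hdeg : ∑ x ∈ G, ∑ i, (if x ∈ T i then 1 else 0) = ∑ i, (T i).card := by
    rw [Finset.sum_comm]
    exact Finset.sum_congr rfl fun i _ => hcard _ (hT i)
  have hsq : ∑ x ∈ G, (∑ i, (if x ∈ T i then 1 else 0)) ^ 2 = ∑ i, ∑ j, (T i ∩ T j).card := by
    simp_rw [sq, Finset.sum_mul_sum]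
    rw [Finset.sum_comm]
    refine Finset.sum_congr rfl fun i _ => ?_
    rw [Finset.sum_comm]
    refine Finset.sum_congr rfl fun j _ => ?_
    rw [← hcard _ (Finset.inter_subset_left.trans (hT i))]
    refine Finset.sum_congr rfl fun x _ => ?_
    by_cases h : x ∈ T i <;> simp [h]
  rw [← hdeg, ← hsq]
  exact sq_sum_le_card_mul_sum_sq

/-- Upper bound for the number of large sets inside a ground set `G` having
small pairwise intersections. -/
theorem number_of_sets_bound {α : Type*} [DecidableEq α] (n k l : ℕ) (hn : 1 ≤ n)
    (hl : 0 < l) (hkl : l ≤ k) (G : Finset α) (S : Fin n → Finset α)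
    (hsub : ∀ i, S i ⊆ G)
    (hsize : ∀ i, k ≤ (S i).card)
    (hinter : ∀ i j, i ≠ j → ((S i) ∩ (S j)).card ≤ l)
    (hlG : (l : ℝ) * (G.card : ℝ) < (k : ℝ) ^ 2) :
    (n : ℝ) ≤ ((G.card : ℝ) / (k : ℝ)) / (1 - (l : ℝ) * (G.card : ℝ) / (k : ℝ) ^ 2) := by
  choose T hTS hTk using fun i => Finset.exists_subset_card_eq (hsize i)
  have hpair : ∀ i j, (T i ∩ T j).card ≤ l + if i = j then k else 0 := fun i j => by
    split_ifs with h
    · subst h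
      simp [hTk]
    · exact (Finset.card_le_card (Finset.inter_subset_inter (hTS i) (hTS j))).trans (hinter i j h)
  have hsum : ∑ i, ∑ j, (T i ∩ T j).card ≤ n * (n * l + k) :=
    (Finset.sum_le_sum fun i _ => Finset.sum_le_sum fun j _ => hpair i j).trans
      (by simp [Finset.sum_add_distrib])
  have hcount : (n * k) ^ 2 ≤ G.card * (n * (n * l + k)) := by
    have h := Finset.sq_sum_card_le_card_mul_sum_card_inter G T fun i => (hTS i).trans (hsub i)
    simp only [hTk, Finset.sum_const, Finset.card_univ, Fintype.card_fin, smul_eq_mul] at h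
    exact h.trans (Nat.mul_le_mul_left _ hsum)
  have hcount' : ((n : ℝ) * k) ^ 2 ≤ G.card * (n * (n * l + k)) := by exact_mod_cast hcount
  have hn' : (0 : ℝ) < n := by exact_mod_cast hn
  have hk : (0 : ℝ) < k := by exact_mod_cast hl.trans_le hkl
  have hpos : (0 : ℝ) < k ^ 2 - l * G.card := sub_pos.mpr hlG
  have hrw : ((G.card : ℝ) / k) / (1 - l * G.card / k ^ 2) = G.card * k / (k ^ 2 - l * G.card) := by
    rw [one_sub_div (by positivity)]
    field_simp
  rw [hrw, le_div_iff₀ hpos]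
  refine le_of_mul_le_mul_left ?_ hn'
  linarith
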